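/- Let G = PSO(2n) (type D_n, adjoint, n ≥ 3), Y = G/H with H = SO(2n−1), so Σ(Y) = {τ} with τ = 2α_1 + ⋯ + 2α_{n−2} + α_{n−1} + α_n, and let X = G/P for the maximal parabolic P ⊂ H of case D_n(1) with parameter ν ∈ {1, …, n−2}, so that Σ(X) = {σ_1, σ_2} with σ_1 = α_1 + ⋯ + α_ν and σ_2 = 2α_{ν+1} + ⋯ + 2α_{n−2} + α_{n−1} + α_n. Then in 𝔤^∨ the one-dimensional subspaces attached via the pinning satisfy g^∨_{τ^∨} = [g^∨_{σ_1^∨}, g^∨_{σ_2^∨}]; consequently g^∨_{τ^∨} ⊆ 𝔤^∨_X and G^∨_Y ⊆ G^∨_X. -/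

import Mathlib

/-!
Setting.  `G = PSO(2n)` (type `D_n`, adjoint, `n ≥ 3`) with simple roots
`α_1, …, α_n`; `Y = G/H` with `H = SO(2n−1)`, so `Σ(Y) = {τ}` with
`τ = 2α_1 + ⋯ + 2α_{n−2} + α_{n−1} + α_n`; `X = G/P` for the maximal parabolic
`P ⊂ H` of case `D_n(1)` with parameter `ν ∈ {1, …, n−2}`, so
`Σ(X) = {σ_1, σ_2}` with `σ_1 = α_1 + ⋯ + α_ν` and
`σ_2 = 2α_{ν+1} + ⋯ + 2α_{n−2} + α_{n−1} + α_n`.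

`G^∨ = Spin(2n, ℂ)` has Lie algebra `𝔤^∨` of type `D_n` (modeled by the
complex Lie algebra `L`), with Cartan subalgebra, roots `±ε_i ± ε_j` in the
standard basis (weights indexed by coordinate vectors in `Fin n → ℤ`,
`ε_i ↦ Pi.single i 1`, `1`-based: `ε_1 = Pi.single 0 1`), root spaces
`g lam`, pinned nonzero root vectors `e lam ∈ g lam`, and the standard root
space bracket relations (`hbr`, `hbr'`); `bracketSpan U V = [U, V]`.

Via the pinning:
`g^∨_{τ^∨} = [g^∨_{ε_1−ε_{n−1}}, ℂE]` with
`E = e_{ε_{n−1}−ε_n} − e_{ε_{n−1}+ε_n}`;  `σ_1` is a root with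
`σ_1^∨ = ε_1 − ε_{ν+1}` so `g^∨_{σ_1^∨}` is its root space;  `σ_2` is of type
`D` with `g^∨_{σ_2^∨} = [g^∨_{ε_{ν+1}−ε_{n−1}}, ℂE]` when `ν < n−2` and
`g^∨_{σ_2^∨} = ℂE` when `ν = n−2`.

`𝔤X = 𝔤^∨_X ⊆ 𝔤^∨` is the Lie algebra of the dual group `G^∨_X` embedded via
a distinguished homomorphism (a Lie subalgebra containing the simple root
spaces `g^∨_{σ_1^∨}`, `g^∨_{σ_2^∨}`); `DX`, `DY` are the (connected) images of
`G^∨_X`, `G^∨_Y` in `G^∨` with Lie algebras `𝔤X`, `𝔤Y`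
(`IsConnectedSubgroupWithLieAlgebra`), where `𝔤^∨_Y` lies in `𝔤^∨_X` as soon
as `g^∨_{τ^∨}` does (`h𝔤Y`), and inclusions of Lie algebras of connected
subgroups yield inclusions of the subgroups (`hmono`).

**Theorem.** `g^∨_{τ^∨} = [g^∨_{σ_1^∨}, g^∨_{σ_2^∨}]`; consequently
`g^∨_{τ^∨} ⊆ 𝔤^∨_X` and `G^∨_Y ⊆ G^∨_X`.
-/

/-- The roots `±ε_i ± ε_j` (`i ≠ j`) of type `D_n`, in coordinates w.r.t. the
standard basis `ε`. -/
def IsDnRoot (n : ℕ) (lam : Fin n → ℤ) : Prop :=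
  ∃ i j : Fin n, i ≠ j ∧
    (lam = Pi.single i 1 - Pi.single j 1 ∨
     lam = Pi.single i 1 + Pi.single j 1 ∨
     lam = -(Pi.single i 1) - Pi.single j 1)

/-- The span of all brackets `⁅u, v⁆` with `u ∈ U`, `v ∈ V`. -/
def bracketSpan {L : Type*} [LieRing L] [LieAlgebra ℂ L]
    (U V : Submodule ℂ L) : Submodule ℂ L :=
  Submodule.span ℂ {x | ∃ u ∈ U, ∃ v ∈ V, x = ⁅u, v⁆}

theorem IsDnRoot.single_sub_single {n : ℕ} {i j : Fin n} (h : i ≠ j) :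
    IsDnRoot n (Pi.single i 1 - Pi.single j 1) :=
  ⟨i, j, h, Or.inl rfl⟩

/-- A root of type `D_n` has at most two nonzero coordinates. -/
theorem IsDnRoot.apply_eq_zero {n : ℕ} {lam : Fin n → ℤ} (h : IsDnRoot n lam)
    {a b c : Fin n} (hab : a ≠ b) (hac : a ≠ c) (hbc : b ≠ c)
    (ha : lam a ≠ 0) (hb : lam b ≠ 0) : lam c = 0 := by
  obtain ⟨i, j, -, h⟩ := h
  have key : ∀ k, k ≠ i → k ≠ j → lam k = 0 := by
    intro k hi hj
    rcases h with rfl | rfl | rfl <;> simp [hi, hj]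
  by_contra hc
  have h1 : a = i ∨ a = j := by by_contra! hh; exact ha (key a hh.1 hh.2)
  have h2 : b = i ∨ b = j := by by_contra! hh; exact hb (key b hh.1 hh.2)
  have h3 : c = i ∨ c = j := by by_contra! hh; exact hc (key c hh.1 hh.2)
  grind

section bracketSpan

variable {L : Type*} [LieRing L] [LieAlgebra ℂ L] {U V W : Submodule ℂ L}

theorem lie_mem_bracketSpan {u v : L} (hu : u ∈ U) (hv : v ∈ V) :
    ⁅u, v⁆ ∈ bracketSpan U V :=
  Submodule.subset_span ⟨u, hu, v, hv, rfl⟩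

theorem bracketSpan_le : bracketSpan U V ≤ W ↔ ∀ u ∈ U, ∀ v ∈ V, (⁅u, v⁆ : L) ∈ W := by
  refine ⟨fun h u hu v hv => h (lie_mem_bracketSpan hu hv), fun h => Submodule.span_le.2 ?_⟩
  rintro _ ⟨u, hu, v, hv, rfl⟩
  exact h u hu v hv

/-- If `U` and `W` commute, then `[[U, V], W] = [U, [V, W]]`. -/
theorem bracketSpan_assoc (h : ∀ u ∈ U, ∀ w ∈ W, ⁅u, w⁆ = 0) :
    bracketSpan (bracketSpan U V) W = bracketSpan U (bracketSpan V W) := by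
  have jacobi : ∀ u ∈ U, ∀ v : L, ∀ w ∈ W, ⁅⁅u, v⁆, w⁆ = ⁅u, ⁅v, w⁆⁆ := by
    intro u hu v w hw
    rw [lie_lie, h u hu w hw, lie_zero, sub_zero]
  apply le_antisymm
  · refine bracketSpan_le.2 fun x hx w hw => ?_
    induction hx using Submodule.span_induction with
    | mem x hx =>
      obtain ⟨u, hu, v, hv, rfl⟩ := hx
      rw [jacobi u hu v w hw]
      exact lie_mem_bracketSpan hu (lie_mem_bracketSpan hv hw)
    | zero => simp
    | add x y _ _ hx hy => rw [add_lie]; exact add_mem hx hy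
    | smul c x _ hx => rw [smul_lie]; exact Submodule.smul_mem _ c hx
  · refine bracketSpan_le.2 fun u hu x hx => ?_
    induction hx using Submodule.span_induction with
    | mem x hx =>
      obtain ⟨v, hv, w, hw, rfl⟩ := hx
      rw [← jacobi u hu v w hw]
      exact lie_mem_bracketSpan (lie_mem_bracketSpan hu hv) hw
    | zero => simp
    | add x y _ _ hx hy => rw [lie_add]; exact add_mem hx hy
    | smul c x _ hx => rw [lie_smul]; exact Submodule.smul_mem _ c hx

/-- For `E = e_{ε_p - ε_q} - e_{ε_p + ε_q}` and distinct indices `i, j, p, q`,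
`[g_{ε_i - ε_p}, ℂE] = [g_{ε_i - ε_j}, [g_{ε_j - ε_p}, ℂE]]`. -/
theorem bracketSpan_rootSpace_span_sub {n : ℕ} {g : (Fin n → ℤ) → Submodule ℂ L}
    {e : (Fin n → ℤ) → L} (he : ∀ lam, IsDnRoot n lam → e lam ∈ g lam)
    (hnonroot : ∀ lam : Fin n → ℤ, lam ≠ 0 → ¬ IsDnRoot n lam → g lam = ⊥)
    (hbr : ∀ lam mu : Fin n → ℤ, lam + mu ≠ 0 →
      bracketSpan (g lam) (g mu) ≤ g (lam + mu))
    (hbr' : ∀ lam mu : Fin n → ℤ, IsDnRoot n lam → IsDnRoot n mu →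
      IsDnRoot n (lam + mu) → bracketSpan (g lam) (g mu) = g (lam + mu))
    {i j p q : Fin n} (hij : i ≠ j) (hip : i ≠ p) (hiq : i ≠ q) (hjp : j ≠ p) (hjq : j ≠ q)
    (hpq : p ≠ q) :
    bracketSpan (g (Pi.single i 1 - Pi.single p 1))
        (Submodule.span ℂ {e (Pi.single p 1 - Pi.single q 1) - e (Pi.single p 1 + Pi.single q 1)}) =
      bracketSpan (g (Pi.single i 1 - Pi.single j 1))
        (bracketSpan (g (Pi.single j 1 - Pi.single p 1))
          (Submodule.span ℂ
            {e (Pi.single p 1 - Pi.single q 1) - e (Pi.single p 1 + Pi.single q 1)})) := by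
  have comm : ∀ mu : Fin n → ℤ, IsDnRoot n mu → mu i = 0 → mu j = 0 → mu p ≠ 0 →
      ∀ u ∈ g (Pi.single i 1 - Pi.single j 1), ⁅u, e mu⁆ = 0 := by
    intro mu hmu mi mj mp u hu
    set lam : Fin n → ℤ := Pi.single i 1 - Pi.single j 1 with hlam
    have ci : (lam + mu) i ≠ 0 := by simp [hlam, mi, hij]
    have cj : (lam + mu) j ≠ 0 := by simp [hlam, mj, hij.symm]
    have cp : (lam + mu) p ≠ 0 := by simpa [hlam, hip.symm, hjp.symm] using mp
    have hne : lam + mu ≠ 0 := fun h => ci (by rw [h]; rfl)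
    have hbot := hnonroot _ hne fun h => cp (h.apply_eq_zero hij hip hjp ci cj)
    have hmem := hbr _ _ hne (lie_mem_bracketSpan hu (he mu hmu))
    rwa [hbot, Submodule.mem_bot] at hmem
  have hcomm : ∀ u ∈ g (Pi.single i 1 - Pi.single j 1),
      ∀ w ∈ Submodule.span ℂ
          {e (Pi.single p 1 - Pi.single q 1) - e (Pi.single p 1 + Pi.single q 1)}, ⁅u, w⁆ = 0 := by
    intro u hu w hw
    obtain ⟨c, rfl⟩ := Submodule.mem_span_singleton.1 hw
    rw [lie_smul, lie_sub,
      comm _ (.single_sub_single hpq) (by simp [hip, hiq]) (by simp [hjp, hjq])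
        (by simp [hpq]) u hu,
      comm _ ⟨p, q, hpq, Or.inr (Or.inl rfl)⟩ (by simp [hip, hiq]) (by simp [hjp, hjq])
        (by simp [hpq]) u hu, sub_zero, smul_zero]
  have hprod := hbr' _ _ (.single_sub_single hij) (.single_sub_single hjp)
    (by rw [sub_add_sub_cancel]; exact .single_sub_single hip)
  rw [sub_add_sub_cancel] at hprod
  rw [← bracketSpan_assoc hcomm, hprod]

end bracketSpan

theorem Dn_case_tau_bracket_of_sigma
    (n : ℕ) (hn : 3 ≤ n)
    {L : Type*} [LieRing L] [LieAlgebra ℂ L]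
    [LieAlgebra.IsSimple ℂ L] [FiniteDimensional ℂ L]
    (g : (Fin n → ℤ) → Submodule ℂ L)
    (e : (Fin n → ℤ) → L)
    (he : ∀ lam, IsDnRoot n lam → e lam ∈ g lam ∧ e lam ≠ 0)
    (hdim : ∀ lam, IsDnRoot n lam → Module.finrank ℂ (g lam) = 1)
    (hnonroot : ∀ lam : Fin n → ℤ, lam ≠ 0 → ¬ IsDnRoot n lam → g lam = ⊥)
    (hbr : ∀ lam mu : Fin n → ℤ, lam + mu ≠ 0 →
      bracketSpan (g lam) (g mu) ≤ g (lam + mu))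
    (hbr' : ∀ lam mu : Fin n → ℤ, IsDnRoot n lam → IsDnRoot n mu →
      IsDnRoot n (lam + mu) → bracketSpan (g lam) (g mu) = g (lam + mu))
    -- the parameter `ν ∈ {1, …, n−2}` of case `D_n(1)`
    (ν : ℕ) (hν1 : 1 ≤ ν) (hν2 : ν ≤ n - 2)
    -- `E`, `g^∨_{τ^∨}`, `g^∨_{σ_1^∨}`, `g^∨_{σ_2^∨}` as above
    (E : L) (gτ gσ1 gσ2 : Submodule ℂ L)
    (hE : E = e (Pi.single (⟨n - 2, by omega⟩ : Fin n) 1 -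
          Pi.single (⟨n - 1, by omega⟩ : Fin n) 1) -
        e (Pi.single (⟨n - 2, by omega⟩ : Fin n) 1 +
          Pi.single (⟨n - 1, by omega⟩ : Fin n) 1))
    (hτdef : gτ = bracketSpan
      (g (Pi.single (⟨0, by omega⟩ : Fin n) 1 -
        Pi.single (⟨n - 2, by omega⟩ : Fin n) 1))
      (Submodule.span ℂ {E}))
    (hσ1def : gσ1 = g (Pi.single (⟨0, by omega⟩ : Fin n) 1 -
      Pi.single (⟨ν, by omega⟩ : Fin n) 1))
    (hσ2def : gσ2 = if ν = n - 2 then Submodule.span ℂ {E} else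
      bracketSpan
        (g (Pi.single (⟨ν, by omega⟩ : Fin n) 1 -
          Pi.single (⟨n - 2, by omega⟩ : Fin n) 1))
        (Submodule.span ℂ {E}))
    -- the Lie algebra `𝔤^∨_X ⊆ 𝔤^∨` of the dual group `G^∨_X`
    (gX : LieSubalgebra ℂ L)
    (hgX1 : gσ1 ≤ gX.toSubmodule) (hgX2 : gσ2 ≤ gX.toSubmodule)
    -- the group-level data: `G^∨ = Spin(2n, ℂ)` with the images of the dual
    -- groups `G^∨_Y ⊆ G^∨_X` as connected subgroups
    {GG : Type*} [Group GG]
    (IsConnectedSubgroupWithLieAlgebra : Subgroup GG → Submodule ℂ L → Prop)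
    (DX DY : Subgroup GG) (gY : Submodule ℂ L)
    (hDX : IsConnectedSubgroupWithLieAlgebra DX gX.toSubmodule)
    (hDY : IsConnectedSubgroupWithLieAlgebra DY gY)
    (hgY : gτ ≤ gX.toSubmodule → gY ≤ gX.toSubmodule)
    (hmono : ∀ (K K' : Subgroup GG) (V V' : Submodule ℂ L),
      IsConnectedSubgroupWithLieAlgebra K V →
      IsConnectedSubgroupWithLieAlgebra K' V' → V ≤ V' → K ≤ K') :
    gτ = bracketSpan gσ1 gσ2 ∧ gτ ≤ gX.toSubmodule ∧ DY ≤ DX := by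
  have main : gτ = bracketSpan gσ1 gσ2 := by
    split_ifs at hσ2def with hν
    · subst hν
      rw [hτdef, hσ1def, hσ2def]
    · rw [hτdef, hσ1def, hσ2def, hE]
      apply bracketSpan_rootSpace_span_sub (fun lam h => (he lam h).1) hnonroot hbr hbr' <;>
        simp only [ne_eq, Fin.mk.injEq] <;> omega
  have hle : gτ ≤ gX.toSubmodule := by
    rw [main]
    exact bracketSpan_le.2 fun u hu v hv => gX.lie_mem (hgX1 hu) (hgX2 hv)
  exact ⟨main, hle, hmono _ _ _ _ hDY hDX (hgY hle)⟩
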